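/- arXiv:math/0511321 — 4 statements merged into one kernel-verified Lean document; each statement's English description precedes it below -/
import Mathlib

section
/- Let T : L¹(M,τ) → L¹(M,τ) be a stochastic operator. Then ᾱ(T) = sup{‖Tu − Tv‖₁/2 : u, v ∈ L¹(M_sa,τ), u ≥ 0, v ≥ 0, ‖u‖₁ = ‖v‖₁ = 1}. -/
open Filter Topology

/-- An abstract model of the non-commutative `L¹`-space `L¹(M,τ)` associated with a
von Neumann algebra `M` equipped with a faithful normal finite trace `τ`,
together with the algebra `M` itself (field `A`), the extended trace `tr` on `L¹(M,τ)`,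
the self-adjoint part `sa` (i.e. `L¹(M_sa,τ)`), the positive cone `Pos`, the duality
pairing `pair a x = τ(a·x)` between `M` and `L¹(M,τ) = M_*`, the unit `𝟙` of `M`
regarded as an element `oneE` of `L¹(M,τ)`, and the adjoint map `adj` sending a bounded
operator on `L¹(M,τ)` to its dual operator on `M`. -/
structure VNL1 where
  /-- the von Neumann algebra `M` -/
  A : Type*
  [ringA : NormedRing A]
  [starA : StarRing A]
  [cstarA : CStarRing A]
  [algA : NormedAlgebra ℂ A]
  [orderA : PartialOrder A]
  [starOrderA : StarOrderedRing A]
  [completeA : CompleteSpace A]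
  /-- the Banach space `L¹(M,τ)` -/
  E : Type*
  [groupE : NormedAddCommGroup E]
  [moduleE : NormedSpace ℂ E]
  [completeE : CompleteSpace E]
  /-- the self-adjoint part `L¹(M_sa,τ)` -/
  sa : Set E
  /-- the positive cone of `L¹(M,τ)` -/
  Pos : Set E
  /-- the trace `τ` extended to `L¹(M,τ)` -/
  tr : E →L[ℂ] ℂ
  /-- the pairing `(a, x) ↦ τ(a·x)` between `M` and `L¹(M,τ)` -/
  pair : A →L[ℂ] E →L[ℂ] ℂ
  /-- the unit `𝟙` of `M` viewed as an element of `L¹(M,τ)` -/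
  oneE : E
  /-- the dual (adjoint) operator on `M` of a bounded operator on `L¹(M,τ) = M_*` -/
  adj : (E →L[ℂ] E) → (A →L[ℂ] A)
  sa_zero : (0 : E) ∈ sa
  sa_add : ∀ {x y : E}, x ∈ sa → y ∈ sa → x + y ∈ sa
  sa_neg : ∀ {x : E}, x ∈ sa → -x ∈ sa
  sa_smul : ∀ (c : ℝ) {x : E}, x ∈ sa → (c : ℂ) • x ∈ sa
  /-- every element of `L¹(M,τ)` is `x₁ + i·x₂` with `x₁, x₂` self-adjoint -/
  decompC : ∀ x : E, ∃ x₁ x₂ : E, x₁ ∈ sa ∧ x₂ ∈ sa ∧ x = x₁ + Complex.I • x₂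
  pos_sa : Pos ⊆ sa
  pos_zero : (0 : E) ∈ Pos
  pos_add : ∀ {x y : E}, x ∈ Pos → y ∈ Pos → x + y ∈ Pos
  pos_smul : ∀ {c : ℝ}, 0 ≤ c → ∀ {x : E}, x ∈ Pos → (c : ℂ) • x ∈ Pos
  pos_pointed : ∀ {x : E}, x ∈ Pos → -x ∈ Pos → x = 0
  /-- `τ` is real on self-adjoint elements -/
  tr_real : ∀ x ∈ sa, (tr x).im = 0
  /-- `τ(x) = ‖x‖₁` for `x ≥ 0` -/
  tr_norm_pos : ∀ x ∈ Pos, tr x = (‖x‖ : ℂ)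
  /-- Jordan decomposition: `x = x⁺ - x⁻` with `‖x‖₁ = ‖x⁺‖₁ + ‖x⁻‖₁` -/
  jordan : ∀ x ∈ sa, ∃ p q : E, p ∈ Pos ∧ q ∈ Pos ∧ x = p - q ∧ ‖x‖ = ‖p‖ + ‖q‖
  oneE_pos : oneE ∈ Pos
  /-- `τ(𝟙·x) = τ(x)` -/
  pair_one : ∀ x : E, pair 1 x = tr x
  /-- positivity of the pairing -/
  pair_pos : ∀ a : A, 0 ≤ a → ∀ x ∈ Pos, 0 ≤ (pair a x).re ∧ (pair a x).im = 0
  /-- `τ((T*a)·x) = τ(a·(T x))` : `adj T` is the dual operator of `T` -/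
  pair_adj : ∀ (T : E →L[ℂ] E) (a : A) (x : E), pair (adj T a) x = pair a (T x)

attribute [instance] VNL1.ringA VNL1.starA VNL1.cstarA VNL1.algA VNL1.orderA
  VNL1.starOrderA VNL1.completeA VNL1.groupE VNL1.moduleE VNL1.completeE

namespace VNL1

variable (V : VNL1)

/-- a positive operator: `Tx ≥ 0` whenever `x ≥ 0` -/
def IsPositiveMap (T : V.E →L[ℂ] V.E) : Prop := ∀ x ∈ V.Pos, T x ∈ V.Pos

/-- a contraction: `‖Tx‖₁ ≤ ‖x‖₁` for all `x ∈ L¹(M_sa,τ)` -/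
def IsContraction (T : V.E →L[ℂ] V.E) : Prop := ∀ x ∈ V.sa, ‖T x‖ ≤ ‖x‖

/-- a stochastic operator: positive and trace-preserving on positive elements -/
def IsStochastic (T : V.E →L[ℂ] V.E) : Prop :=
  V.IsPositiveMap T ∧ ∀ x ∈ V.Pos, V.tr (T x) = V.tr x

/-- `X = {x ∈ L¹(M_sa,τ) : τ(x) = 0}` -/
def X : Set V.E := {x | x ∈ V.sa ∧ V.tr x = 0}

/-- `ᾱ(T) = sup_{x ∈ X, x ≠ 0} ‖Tx‖₁/‖x‖₁` -/
noncomputable def alphaBar (T : V.E →L[ℂ] V.E) : ℝ :=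
  sSup {r : ℝ | ∃ x ∈ V.X, x ≠ 0 ∧ r = ‖T x‖ / ‖x‖}

/-- the Dobrushin coefficient of ergodicity `α(T) = ‖T‖ - ᾱ(T)` -/
noncomputable def alpha (T : V.E →L[ℂ] V.E) : ℝ := ‖T‖ - V.alphaBar T

/-- a projection of the algebra `M` -/
def IsProj (p : V.A) : Prop := IsSelfAdjoint p ∧ IsIdempotentElem p

/-- `T` is smoothing w.r.t. `x`: for every `ε > 0` there are `δ > 0` and `n₀` such that
`τ(p·Tⁿx) < ε` for every projection `p` with `τ(p) < δ` and every `n ≥ n₀`.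
(Here `τ(p) = τ(p·𝟙)` is expressed through the pairing.) -/
def Smoothing (T : V.E →L[ℂ] V.E) (x : V.E) : Prop :=
  ∀ ε : ℝ, 0 < ε → ∃ δ : ℝ, 0 < δ ∧ ∃ n₀ : ℕ, ∀ p : V.A, V.IsProj p →
    (V.pair p V.oneE).re < δ → ∀ n : ℕ, n₀ ≤ n → (V.pair p ((T ^ n) x)).re < ε

/-- `T` is completely mixing: `‖Tⁿ(u - v)‖₁ → 0` for all positive `u, v` of equal norm -/
def CompletelyMixing (T : V.E →L[ℂ] V.E) : Prop :=
  ∀ u ∈ V.Pos, ∀ v ∈ V.Pos, ‖u‖ = ‖v‖ →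
    Tendsto (fun n : ℕ => ‖(T ^ n) (u - v)‖) atTop (nhds 0)

/-- `ρ̄(T) = sup { lim_n ‖Tⁿ(u-v)‖₁/‖u-v‖₁ : u, v ≥ 0, ‖u‖₁ = ‖v‖₁ }` -/
noncomputable def rhoBar (T : V.E →L[ℂ] V.E) : ℝ :=
  sSup {r : ℝ | ∃ u ∈ V.Pos, ∃ v ∈ V.Pos, ‖u‖ = ‖v‖ ∧ u ≠ v ∧
    Tendsto (fun n : ℕ => ‖(T ^ n) (u - v)‖ / ‖u - v‖) atTop (nhds r)}

/-- the asymptotic Dobrushin coefficient of ergodicity `ρ(T) = lim_n ‖Tⁿ‖ - ρ̄(T)` -/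
noncomputable def rho (T : V.E →L[ℂ] V.E) : ℝ :=
  Filter.limsup (fun n : ℕ => ‖T ^ n‖) Filter.atTop - V.rhoBar T

end VNL1

/-- **Lemma 3.3.** For a stochastic operator `T`,
`ᾱ(T) = sup { ‖Tu - Tv‖₁/2 : u, v ≥ 0, ‖u‖₁ = ‖v‖₁ = 1 }`. -/
theorem alphaBar_eq_sup_pairs (V : VNL1) (T : V.E →L[ℂ] V.E) (hT : V.IsStochastic T) :
    V.alphaBar T = sSup {r : ℝ | ∃ u ∈ V.Pos, ∃ v ∈ V.Pos,
      ‖u‖ = 1 ∧ ‖v‖ = 1 ∧ r = ‖T u - T v‖ / 2} := by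
  have hA : BddAbove {r : ℝ | ∃ x ∈ V.X, x ≠ 0 ∧ r = ‖T x‖ / ‖x‖} := by
    refine ⟨‖T‖, ?_⟩
    rintro r ⟨x, _, _, rfl⟩
    exact div_le_of_le_mul₀ (norm_nonneg _) (norm_nonneg _) (T.le_opNorm x)
  have hA0 : 0 ≤ sSup {r : ℝ | ∃ x ∈ V.X, x ≠ 0 ∧ r = ‖T x‖ / ‖x‖} := by
    apply Real.sSup_nonneg
    rintro r ⟨x, _, _, rfl⟩
    positivity
  have hB : BddAbove {r : ℝ | ∃ u ∈ V.Pos, ∃ v ∈ V.Pos,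
      ‖u‖ = 1 ∧ ‖v‖ = 1 ∧ r = ‖T u - T v‖ / 2} := by
    refine ⟨‖T‖, ?_⟩
    rintro r ⟨u, _, v, _, hu, hv, rfl⟩
    have h1 := norm_sub_le (T u) (T v)
    have h2 := T.le_opNorm u
    have h3 := T.le_opNorm v
    rw [hu] at h2
    rw [hv] at h3
    linarith
  have hB0 : 0 ≤ sSup {r : ℝ | ∃ u ∈ V.Pos, ∃ v ∈ V.Pos,
      ‖u‖ = 1 ∧ ‖v‖ = 1 ∧ r = ‖T u - T v‖ / 2} := by
    apply Real.sSup_nonneg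
    rintro r ⟨u, _, v, _, hu, hv, rfl⟩
    positivity
  unfold VNL1.alphaBar
  apply le_antisymm
  · refine Real.sSup_le ?_ hB0
    rintro r ⟨x, ⟨hxs, hx0⟩, hne, rfl⟩
    apply le_csSup hB
    obtain ⟨p, q, hp, hq, hx, hn⟩ := V.jordan x hxs
    have hpq : ‖p‖ = ‖q‖ := by
      rw [hx, map_sub, V.tr_norm_pos p hp, V.tr_norm_pos q hq, sub_eq_zero] at hx0
      exact_mod_cast hx0
    have hxpos : 0 < ‖x‖ := norm_pos_iff.mpr hne
    have hppos : 0 < ‖p‖ := by linarith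
    have hc : 0 ≤ ‖p‖⁻¹ := by positivity
    have hnorm : ‖((‖p‖⁻¹ : ℝ) : ℂ)‖ = ‖p‖⁻¹ := by
      rw [Complex.norm_real, Real.norm_of_nonneg hc]
    refine ⟨((‖p‖⁻¹ : ℝ) : ℂ) • p, V.pos_smul hc hp, ((‖p‖⁻¹ : ℝ) : ℂ) • q,
      V.pos_smul hc hq, ?_, ?_, ?_⟩
    · rw [norm_smul, hnorm, inv_mul_cancel₀ hppos.ne']
    · rw [norm_smul, hnorm, ← hpq, inv_mul_cancel₀ hppos.ne']
    · rw [← map_sub, ← smul_sub, ← hx, map_smul, norm_smul, hnorm, hn, ← hpq]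
      field_simp
      ring
  · refine Real.sSup_le ?_ hA0
    rintro r ⟨u, hu, v, hv, hu1, hv1, rfl⟩
    rcases eq_or_ne u v with rfl | huv
    · simpa using hA0
    have hne : u - v ≠ 0 := sub_ne_zero.mpr huv
    have hpos : 0 < ‖u - v‖ := norm_pos_iff.mpr hne
    have h2 : ‖u - v‖ ≤ 2 := by
      have := norm_sub_le u v
      linarith
    refine le_trans ?_ (le_csSup hA ⟨u - v, ⟨?_, ?_⟩, hne, rfl⟩)
    · rw [map_sub]
      exact div_le_div_of_nonneg_left (norm_nonneg _) hpos h2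
    · rw [sub_eq_add_neg]
      exact V.sa_add (V.pos_sa hu) (V.sa_neg (V.pos_sa hv))
    · rw [map_sub, V.tr_norm_pos u hu, V.tr_norm_pos v hv, hu1, hv1, sub_self]
end

section
/- If T : L¹(M,τ) → L¹(M,τ) is a stochastic operator, then ρ̄(T) = 0 or ρ̄(T) = 1. -/
open Filter Topology

theorem VNL1.norm_map_pos (V : VNL1) (T : V.E →L[ℂ] V.E) (hT : V.IsStochastic T)
    (x : V.E) (hx : x ∈ V.Pos) : ‖T x‖ = ‖x‖ := by
  have h := hT.2 x hx
  rw [V.tr_norm_pos _ hx, V.tr_norm_pos _ (hT.1 x hx)] at h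
  exact_mod_cast h

theorem VNL1.pow_pos_norm (V : VNL1) (T : V.E →L[ℂ] V.E) (hT : V.IsStochastic T)
    (x : V.E) (hx : x ∈ V.Pos) (n : ℕ) : (T ^ n) x ∈ V.Pos ∧ ‖(T ^ n) x‖ = ‖x‖ := by
  induction n with
  | zero => exact ⟨by simpa using hx, by simp⟩
  | succ n ih =>
    have e : (T ^ (n + 1)) x = T ((T ^ n) x) := by rw [pow_succ']; rfl
    rw [e]
    exact ⟨hT.1 _ ih.1, (V.norm_map_pos T hT _ ih.1).trans ih.2⟩

theorem VNL1.contr_sub (V : VNL1) (T : V.E →L[ℂ] V.E) (hT : V.IsStochastic T)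
    (u v : V.E) (hu : u ∈ V.Pos) (hv : v ∈ V.Pos) : ‖T (u - v)‖ ≤ ‖u - v‖ := by
  have hs : u - v ∈ V.sa := by
    rw [sub_eq_add_neg]
    exact V.sa_add (V.pos_sa hu) (V.sa_neg (V.pos_sa hv))
  obtain ⟨p, q, hp, hq, h1, h2⟩ := V.jordan _ hs
  rw [h2, h1, map_sub, ← V.norm_map_pos T hT p hp, ← V.norm_map_pos T hT q hq]
  exact norm_sub_le _ _

theorem VNL1.pow_antitone (V : VNL1) (T : V.E →L[ℂ] V.E) (hT : V.IsStochastic T)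
    (u v : V.E) (hu : u ∈ V.Pos) (hv : v ∈ V.Pos) :
    Antitone (fun n : ℕ => ‖(T ^ n) (u - v)‖) := by
  refine antitone_nat_of_succ_le fun n => ?_
  have e : (T ^ (n + 1)) (u - v) = T ((T ^ n) (u - v)) := by rw [pow_succ']; rfl
  rw [e, map_sub (T ^ n)]
  exact V.contr_sub T hT _ _ (V.pow_pos_norm T hT u hu n).1 (V.pow_pos_norm T hT v hv n).1

/-- **Theorem 4.2.** If `T` is a stochastic operator then `ρ̄(T) = 0` or `ρ̄(T) = 1`. -/
theorem rhoBar_zero_or_one (V : VNL1) (T : V.E →L[ℂ] V.E) (hT : V.IsStochastic T) :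
    V.rhoBar T = 0 ∨ V.rhoBar T = 1 := by
  classical
  unfold VNL1.rhoBar
  set S : Set ℝ := {r : ℝ | ∃ u ∈ V.Pos, ∃ v ∈ V.Pos, ‖u‖ = ‖v‖ ∧ u ≠ v ∧
    Tendsto (fun n : ℕ => ‖(T ^ n) (u - v)‖ / ‖u - v‖) atTop (nhds r)} with hS
  have hnn : ∀ r ∈ S, 0 ≤ r := by
    rintro r ⟨u, hu, v, hv, he, hne, hlim⟩
    exact ge_of_tendsto' hlim fun n => by positivity
  have hle : ∀ r ∈ S, r ≤ 1 := by
    rintro r ⟨u, hu, v, hv, he, hne, hlim⟩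
    refine le_of_tendsto' hlim fun n => div_le_one_of_le₀ ?_ (norm_nonneg _)
    simpa using V.pow_antitone T hT u v hu hv (Nat.zero_le n)
  by_cases h0 : ∀ r ∈ S, r = 0
  · left
    apply le_antisymm
    · exact Real.sSup_le (fun r hr => (h0 r hr).le) le_rfl
    · exact Real.sSup_nonneg hnn
  right
  push Not at h0
  obtain ⟨r, hr, hr0⟩ := h0
  have hrpos : 0 < r := lt_of_le_of_ne (hnn r hr) (Ne.symm hr0)
  obtain ⟨u, hu, v, hv, he, hne, hlim⟩ := hr
  have hd : 0 < ‖u - v‖ := norm_pos_iff.2 (sub_ne_zero.2 hne)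
  have hc : 0 < r * ‖u - v‖ := by positivity
  set c : ℝ := r * ‖u - v‖ with hcdef
  have hlim' : Tendsto (fun n : ℕ => ‖(T ^ n) (u - v)‖) atTop (nhds c) := by
    have h := hlim.mul_const ‖u - v‖
    refine h.congr fun n => ?_
    field_simp
  have hge : ∀ n, c ≤ ‖(T ^ n) (u - v)‖ := fun n =>
    (V.pow_antitone T hT u v hu hv).le_of_tendsto hlim' n
  have hbdd : BddAbove S := ⟨1, hle⟩
  have hmem : ∀ k : ℕ, c / ‖(T ^ k) (u - v)‖ ∈ S := by
    intro k
    have hk : 0 < ‖(T ^ k) (u - v)‖ := hc.trans_le (hge k)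
    obtain ⟨a1, a2⟩ := V.pow_pos_norm T hT u hu k
    obtain ⟨b1, b2⟩ := V.pow_pos_norm T hT v hv k
    refine ⟨(T ^ k) u, a1, (T ^ k) v, b1, by rw [a2, b2, he], ?_, ?_⟩
    · rw [← sub_ne_zero, ← map_sub]
      exact norm_pos_iff.1 hk
    · rw [← map_sub]
      refine Tendsto.div_const ?_ _
      refine ((tendsto_add_atTop_iff_nat k).2 hlim').congr fun n => ?_
      rw [pow_add]; rfl
  have hto : Tendsto (fun k : ℕ => c / ‖(T ^ k) (u - v)‖) atTop (nhds 1) := by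
    have h := (tendsto_const_nhds (x := c)).div hlim' hc.ne'
    rwa [div_self hc.ne'] at h
  apply le_antisymm
  · exact Real.sSup_le hle zero_le_one
  · exact le_of_tendsto' hto fun k => le_csSup hbdd (hmem k)
end

section
/- Let T : L¹(M,τ) → L¹(M,τ) be a stochastic operator with ρ̄(T) < 1. Then for every x ∈ L¹(M_sa,τ) with τ(x) = 0 one has lim_{n→∞} ‖Tⁿx‖₁ = 0. -/
open Filter Topology

namespace VNL1

lemma stoch_norm_pos (V : VNL1) {T : V.E →L[ℂ] V.E} (hT : V.IsStochastic T)
    {p : V.E} (hp : p ∈ V.Pos) : ‖T p‖ = ‖p‖ := by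
  have h1 := V.tr_norm_pos p hp
  have h2 := V.tr_norm_pos _ (hT.1 p hp)
  rw [hT.2 p hp, h1] at h2
  exact_mod_cast h2.symm

/-- A stochastic operator maps `X` into itself and is a contraction there. -/
lemma stoch_X (V : VNL1) {T : V.E →L[ℂ] V.E} (hT : V.IsStochastic T)
    {x : V.E} (hx : x ∈ V.X) : T x ∈ V.X ∧ ‖T x‖ ≤ ‖x‖ := by
  obtain ⟨hs, ht⟩ := hx
  obtain ⟨p, q, hp, hq, rfl, hn⟩ := V.jordan x hs
  refine ⟨⟨?_, ?_⟩, ?_⟩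
  · rw [map_sub, sub_eq_add_neg]
    exact V.sa_add (V.pos_sa (hT.1 p hp)) (V.sa_neg (V.pos_sa (hT.1 q hq)))
  · rw [map_sub, map_sub, hT.2 p hp, hT.2 q hq, ← map_sub, ht]
  · rw [map_sub, hn, ← V.stoch_norm_pos hT hp, ← V.stoch_norm_pos hT hq]
    exact norm_sub_le _ _

lemma stoch_pow_X (V : VNL1) {T : V.E →L[ℂ] V.E} (hT : V.IsStochastic T)
    {x : V.E} (hx : x ∈ V.X) (n : ℕ) : (T ^ n) x ∈ V.X := by
  induction n with
  | zero => simpa using hx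
  | succ n ih =>
    rw [pow_succ']
    exact (V.stoch_X hT ih).1

lemma stoch_antitone (V : VNL1) {T : V.E →L[ℂ] V.E} (hT : V.IsStochastic T)
    {x : V.E} (hx : x ∈ V.X) : Antitone (fun n : ℕ => ‖(T ^ n) x‖) := by
  refine antitone_nat_of_succ_le fun n => ?_
  rw [pow_succ']
  exact (V.stoch_X hT (V.stoch_pow_X hT hx n)).2

lemma diff_mem_X (V : VNL1) {u v : V.E} (hu : u ∈ V.Pos) (hv : v ∈ V.Pos)
    (h : ‖u‖ = ‖v‖) : u - v ∈ V.X := by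
  refine ⟨?_, ?_⟩
  · rw [sub_eq_add_neg]
    exact V.sa_add (V.pos_sa hu) (V.sa_neg (V.pos_sa hv))
  · rw [map_sub, V.tr_norm_pos u hu, V.tr_norm_pos v hv, h, sub_self]

/-- The limit along the orbit is bounded by `ρ̄(T) ‖x‖`. -/
lemma limit_le (V : VNL1) {T : V.E →L[ℂ] V.E} (hT : V.IsStochastic T)
    {x : V.E} (hx : x ∈ V.X) {l : ℝ}
    (hl : Tendsto (fun n : ℕ => ‖(T ^ n) x‖) atTop (nhds l)) :
    l ≤ V.rhoBar T * ‖x‖ := by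
  by_cases h0 : x = 0
  · subst h0
    have : l = 0 := tendsto_nhds_unique hl (by simp)
    simp [this]
  have hpos : 0 < ‖x‖ := norm_pos_iff.2 h0
  rw [← div_le_iff₀ hpos]
  refine le_csSup ⟨1, ?_⟩ ?_
  · rintro r ⟨u, hu, v, hv, huv, -, hr⟩
    refine le_of_tendsto' hr fun n => ?_
    refine div_le_one_of_le₀ ?_ (norm_nonneg _)
    simpa using V.stoch_antitone hT (V.diff_mem_X hu hv huv) (Nat.zero_le n)
  · obtain ⟨p, q, hp, hq, hpq, -⟩ := V.jordan x hx.1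
    have ht := hx.2
    rw [hpq, map_sub, V.tr_norm_pos p hp, V.tr_norm_pos q hq, sub_eq_zero] at ht
    refine ⟨p, hp, q, hq, by exact_mod_cast ht, ?_, ?_⟩
    · rintro rfl
      exact h0 (by rw [hpq, sub_self])
    · rw [← hpq]
      exact hl.div_const _

end VNL1

/-- Part of the proof of Theorem 4.2: if `T` is stochastic and `ρ̄(T) < 1`, then
`‖Tⁿx‖₁ → 0` for every self-adjoint `x` with `τ(x) = 0`. -/
theorem tendsto_zero_of_rhoBar_lt_one (V : VNL1) (T : V.E →L[ℂ] V.E)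
    (hT : V.IsStochastic T) (h : V.rhoBar T < 1) :
    ∀ x ∈ V.sa, V.tr x = 0 →
      Tendsto (fun n : ℕ => ‖(T ^ n) x‖) atTop (nhds 0) := by
  intro x hs ht
  have hx : x ∈ V.X := ⟨hs, ht⟩
  have hanti := V.stoch_antitone hT hx
  have hbdd : BddBelow (Set.range (fun n : ℕ => ‖(T ^ n) x‖)) :=
    ⟨0, by rintro _ ⟨n, rfl⟩; exact norm_nonneg _⟩
  have hl := tendsto_atTop_ciInf hanti hbdd
  generalize (⨅ n : ℕ, ‖(T ^ n) x‖) = l at hl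
  have hl0 : 0 ≤ l := ge_of_tendsto' hl fun n => norm_nonneg _
  have key : ∀ m : ℕ, l ≤ V.rhoBar T * ‖(T ^ m) x‖ := by
    intro m
    refine V.limit_le hT (V.stoch_pow_X hT hx m) ?_
    have := hl.comp (tendsto_add_atTop_nat m)
    refine this.congr fun n => ?_
    simp only [Function.comp]
    rw [pow_add]
    rfl
  have h2 : l ≤ V.rhoBar T * l := ge_of_tendsto' (hl.const_mul _) key
  have h3 : l = 0 := by nlinarith
  rwa [h3] at hl
end

section
/- Let T : L¹(M,τ) → L¹(M,τ) be a positive contraction, y ∈ L¹(M,τ) with y ≥ 0, and suppose α := lim_{n→∞} ‖Tⁿy‖₁ ≠ 0. Then there exists a nonzero positive linear functional λ on M with λ(1) = α which is invariant under the adjoint action of T, i.e. λ(T*x) = λ(x) for all x ∈ M (equivalently T**λ = λ on M**). -/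
open Filter Topology

/-- Weak-star limits of Cesaro means of a bounded sequence of functionals. -/
theorem exists_cesaro_limit {A : Type*} [SeminormedAddCommGroup A] [NormedSpace ℂ A]
    (f : ℕ → (A →L[ℂ] ℂ)) (C : ℝ) (hf : ∀ n, ‖f n‖ ≤ C) :
    ∃ (lam : A →L[ℂ] ℂ) (U : Ultrafilter ℕ), (U : Filter ℕ) ≤ atTop ∧
      ∀ a, Tendsto (fun N : ℕ => ((N : ℝ)⁻¹) • ∑ n ∈ Finset.range N, f n a) U (𝓝 (lam a)) := by
  have hC : 0 ≤ C := (norm_nonneg _).trans (hf 0)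
  let g : ℕ → (A →L[ℂ] ℂ) := fun N => ((N : ℝ)⁻¹) • ∑ n ∈ Finset.range N, f n
  have hg : ∀ N, ‖g N‖ ≤ C := by
    intro N
    have h1 : ‖∑ n ∈ Finset.range N, f n‖ ≤ N * C := by
      refine (norm_sum_le_of_le _ (fun n _ => hf n)).trans ?_
      simp
    have h2 : ‖g N‖ ≤ (N : ℝ)⁻¹ * (N * C) := by
      refine (norm_smul_le ((N : ℝ)⁻¹) (∑ n ∈ Finset.range N, f n)).trans ?_
      rw [Real.norm_of_nonneg (by positivity)]
      gcongr
    refine h2.trans ?_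
    rcases Nat.eq_zero_or_pos N with h | h
    · subst h; simpa using hC
    · have : (N : ℝ) ≠ 0 := by positivity
      rw [inv_mul_cancel_left₀ this]
  let K : Set (WeakDual ℂ A) := WeakDual.toStrongDual ⁻¹' Metric.closedBall 0 C
  have hK : IsCompact K := WeakDual.isCompact_closedBall 0 C
  let U : Ultrafilter ℕ := Ultrafilter.of atTop
  have hU : (U : Filter ℕ) ≤ atTop := Ultrafilter.of_le _
  let G : ℕ → WeakDual ℂ A := fun N => StrongDual.toWeakDual (g N)
  have hGK : ∀ N, G N ∈ K := by
    intro N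
    change g N ∈ Metric.closedBall 0 C
    simpa using hg N
  obtain ⟨l, -, hl⟩ := hK.ultrafilter_le_nhds (U.map G) (by
    rw [le_principal_iff]
    exact Filter.mem_map.2 (Filter.univ_mem' hGK))
  refine ⟨WeakDual.toStrongDual l, U, hU, fun a => ?_⟩
  have h3 : Tendsto G U (𝓝 l) := hl
  have h4 := ((WeakDual.eval_continuous (𝕜 := ℂ) a).tendsto l).comp h3
  refine h4.congr fun N => ?_
  change (((N : ℝ)⁻¹) • ∑ n ∈ Finset.range N, f n) a = _
  simp

/-- Part of the proof of Theorem 4.3: if `T` is a positive contraction, `y ≥ 0` and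
`α = lim_n ‖Tⁿy‖₁ ≠ 0`, then there is a nonzero positive linear functional `λ` on `M`
with `λ(𝟙) = α` invariant under the adjoint action of `T`, i.e. `λ(T*x) = λ(x)` for all
`x ∈ M`. -/
theorem invariant_functional (V : VNL1) (T : V.E →L[ℂ] V.E)
    (hTpos : V.IsPositiveMap T) (hTc : V.IsContraction T)
    (y : V.E) (hy : y ∈ V.Pos) (α : ℝ)
    (hα : Tendsto (fun n : ℕ => ‖(T ^ n) y‖) atTop (nhds α)) (hα0 : α ≠ 0) :
    ∃ lam : V.A →L[ℂ] ℂ, lam ≠ 0 ∧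
      (∀ a : V.A, 0 ≤ a → 0 ≤ (lam a).re ∧ (lam a).im = 0) ∧
      lam 1 = (α : ℂ) ∧ ∀ a : V.A, lam (V.adj T a) = lam a := by
  have hpos : ∀ n : ℕ, (T ^ n) y ∈ V.Pos := by
    intro n
    induction n with
    | zero => simpa using hy
    | succ k ih =>
      rw [pow_succ']
      exact hTpos _ ih
  have hnorm : ∀ n : ℕ, ‖(T ^ n) y‖ ≤ ‖y‖ := by
    intro n
    induction n with
    | zero => simp
    | succ k ih =>
      rw [pow_succ']
      exact (hTc _ (V.pos_sa (hpos k))).trans ih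
  obtain ⟨lam, U, hU, hlam⟩ := exists_cesaro_limit (fun n => V.pair.flip ((T ^ n) y))
    (‖V.pair.flip‖ * ‖y‖) (fun n => (V.pair.flip.le_opNorm _).trans (by gcongr; exact hnorm n))
  simp only [ContinuousLinearMap.flip_apply] at hlam
  have h1 : lam 1 = (α : ℂ) := by
    refine tendsto_nhds_unique (hlam 1) (Tendsto.mono_left ?_ hU)
    have h := (Complex.continuous_ofReal.tendsto α).comp hα.cesaro
    refine h.congr fun N => ?_
    simp only [Function.comp, V.pair_one, V.tr_norm_pos _ (hpos _)]
    simp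
  refine ⟨lam, ?_, ?_, h1, ?_⟩
  · rintro rfl
    apply hα0
    simpa using h1.symm
  · intro a ha
    have hre := (Complex.continuous_re.tendsto _).comp (hlam a)
    have him := (Complex.continuous_im.tendsto _).comp (hlam a)
    constructor
    · refine ge_of_tendsto' hre fun N => ?_
      simp only [Function.comp, Complex.smul_re, Complex.re_sum, smul_eq_mul]
      exact mul_nonneg (by positivity)
        (Finset.sum_nonneg fun n _ => (V.pair_pos a ha _ (hpos n)).1)
    · refine tendsto_nhds_unique him (tendsto_const_nhds.congr fun N => ?_)
      simp only [Function.comp, Complex.smul_im, Complex.im_sum, smul_eq_mul]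
      rw [Finset.sum_eq_zero fun n _ => (V.pair_pos a ha _ (hpos n)).2, mul_zero]
  · intro a
    rw [← sub_eq_zero]
    refine tendsto_nhds_unique ((hlam (V.adj T a)).sub (hlam a)) (Tendsto.mono_left ?_ hU)
    have hb : ∀ n : ℕ, ‖V.pair a ((T ^ n) y)‖ ≤ ‖V.pair a‖ * ‖y‖ := fun n =>
      ((V.pair a).le_opNorm _).trans (by gcongr; exact hnorm n)
    have h0 : Tendsto (fun N : ℕ => (N : ℝ)⁻¹ * (‖V.pair a‖ * ‖y‖ + ‖V.pair a‖ * ‖y‖))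
        atTop (𝓝 0) := by
      simpa using (tendsto_inv_atTop_nhds_zero_nat (𝕜 := ℝ)).mul_const
        (‖V.pair a‖ * ‖y‖ + ‖V.pair a‖ * ‖y‖)
    refine squeeze_zero_norm (fun N => ?_) h0
    rw [← smul_sub, ← Finset.sum_sub_distrib]
    have hs : ∑ n ∈ Finset.range N, (V.pair (V.adj T a) ((T ^ n) y) - V.pair a ((T ^ n) y))
        = V.pair a ((T ^ N) y) - V.pair a ((T ^ 0) y) := by
      rw [← Finset.sum_range_sub (fun n => V.pair a ((T ^ n) y))]
      refine Finset.sum_congr rfl fun n _ => ?_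
      rw [V.pair_adj, pow_succ']
      rfl
    rw [hs]
    refine (norm_smul_le ((N : ℝ)⁻¹) _).trans ?_
    rw [Real.norm_of_nonneg (by positivity)]
    gcongr
    exact (norm_sub_le _ _).trans (add_le_add (hb N) (hb 0))
end
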